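/- arXiv:1404.4258 — 3 statements merged into one kernel-verified Lean document; each statement's English description precedes it below -/
import Mathlib

section
/- Let Φw_L be a Lyapunov function with rate β ∈ [0,1) for the finite MDP with transition probabilities P and discount γ. Let R₁ and R₂ be two reward functions for the same S, A, P, γ, with optimal value functions V₁* and V₂* respectively, and suppose ‖V₁* − V₂*‖_∞ ≤ 2ε_p/(1−γ) for some ε_p ≥ 0. Let w* ∈ W minimize ‖V₂* − Φw‖_{∞,1/Φw_L} over W, set w̄ = w* + ‖V₂* − Φw*‖_{∞,1/Φw_L} · (2/(1−β) − 1) · w_L, and assume w̄ ∈ W. Let ρ be a probability distribution on S and let w̃ be a RALP solution for the MDP with reward R₂ (all state-action constraints present). Then ‖V₁* − Φw̃‖_{1,ρ} ≤ (2 ∑_s ρ(s)(Φw_L)(s) / (1−β)) · min_{w∈W} ‖V₂* − Φw‖_{∞,1/Φw_L} + 2ε_p/(1−γ). -/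
open Finset

section Defs

variable {S A : Type*} [Fintype S] [Nonempty S] [Fintype A] [Nonempty A]

/-- The Bellman operator: `(T V)(s) = max_a [R(s) + γ ∑_{s'} P(s'|s,a) V(s')]`. -/
noncomputable def bellman (P : S → A → S → ℝ) (R : S → ℝ) (γ : ℝ) (V : S → ℝ) (s : S) : ℝ :=
  univ.sup' univ_nonempty fun a => R s + γ * ∑ s', P s a s' * V s'

/-- The operator `H`: `(H L)(s) = max_a ∑_{s'} P(s'|s,a) L(s')`. -/
noncomputable def Hop (P : S → A → S → ℝ) (L : S → ℝ) (s : S) : ℝ :=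
  univ.sup' univ_nonempty fun a => ∑ s', P s a s' * L s'

/-- `(Φ w)(s) = ∑ i, Φ_i(s) w_i`. -/
def phiW {k : ℕ} (Φ : S → Fin (k + 1) → ℝ) (w : Fin (k + 1) → ℝ) (s : S) : ℝ :=
  ∑ i, Φ s i * w i

/-- `‖w‖_{-1}`: the ℓ¹ norm of `w` with the bias coordinate (index 0) excluded. -/
def normNeg1 {k : ℕ} (w : Fin (k + 1) → ℝ) : ℝ :=
  ∑ i ∈ Finset.univ.erase 0, |w i|

/-- The weighted max-norm `‖U‖_{∞,1/L} = max_s |U(s)| / L(s)`. -/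
noncomputable def wmaxNorm (L U : S → ℝ) : ℝ :=
  univ.sup' univ_nonempty fun s => |U s| / L s

/-- The weighted L¹ norm `‖U‖_{1,ρ} = ∑_s ρ(s) |U(s)|`. -/
def w1Norm (ρ U : S → ℝ) : ℝ := ∑ s, ρ s * |U s|

/-- The max-absolute-value norm on functions `S → ℝ`. -/
noncomputable def maxNorm (U : S → ℝ) : ℝ :=
  univ.sup' univ_nonempty fun s => |U s|

/-- RALP feasibility: `‖w‖_{-1} ≤ ψ` and all Bellman (state-action) constraints hold. -/
def RALPfeasible {k : ℕ} (P : S → A → S → ℝ) (R : S → ℝ) (γ : ℝ)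
    (Φ : S → Fin (k + 1) → ℝ) (ψ : ℝ) (w : Fin (k + 1) → ℝ) : Prop :=
  normNeg1 w ≤ ψ ∧
    ∀ s a, R s + γ * ∑ s', P s a s' * phiW Φ w s' ≤ phiW Φ w s

/-- A RALP solution: a feasible `w` minimizing `∑ s, ρ s * (Φ w)(s)` over feasible vectors. -/
def RALPsolution {k : ℕ} (P : S → A → S → ℝ) (R : S → ℝ) (γ : ℝ)
    (Φ : S → Fin (k + 1) → ℝ) (ψ : ℝ) (ρ : S → ℝ) (w : Fin (k + 1) → ℝ) : Prop :=
  RALPfeasible P R γ Φ ψ w ∧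
    ∀ w', RALPfeasible P R γ Φ ψ w' →
      ∑ s, ρ s * phiW Φ w s ≤ ∑ s, ρ s * phiW Φ w' s

end Defs

section RALPBounds

variable {S A : Type*}

theorem phiW_add_mul {k : ℕ} (Φ : S → Fin (k + 1) → ℝ) (v w : Fin (k + 1) → ℝ) (c : ℝ) (s : S) :
    phiW Φ (fun i => v i + c * w i) s = phiW Φ v s + c * phiW Φ w s := by
  simp only [phiW, mul_sum, ← sum_add_distrib]
  exact sum_congr rfl fun i _ => by ring

variable [Fintype S]

theorem abs_le_wmaxNorm_mul [Nonempty S] {L : S → ℝ} (hL : ∀ s, 0 < L s) (U : S → ℝ) (s : S) :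
    |U s| ≤ wmaxNorm L U * L s :=
  (div_le_iff₀ (hL s)).1 (le_sup' (fun s => |U s| / L s) (mem_univ s))

theorem wmaxNorm_nonneg [Nonempty S] {L : S → ℝ} (hL : ∀ s, 0 < L s) (U : S → ℝ) :
    0 ≤ wmaxNorm L U :=
  have s := Classical.arbitrary S
  (div_nonneg (abs_nonneg (U s)) (hL s).le).trans (le_sup' (fun s => |U s| / L s) (mem_univ s))

variable [Fintype A] [Nonempty A]

/-- A function satisfying all Bellman constraints dominates the optimal value function. -/
theorem le_of_bellman_constraints [Nonempty S] {P : S → A → S → ℝ} {R : S → ℝ} {γ : ℝ}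
    (hγ0 : 0 ≤ γ) (hγ1 : γ < 1) (hP0 : ∀ s a s', 0 ≤ P s a s') (hP1 : ∀ s a, ∑ s', P s a s' = 1)
    {V : S → ℝ} (hV : ∀ s, bellman P R γ V s = V s) {U : S → ℝ}
    (hU : ∀ s a, R s + γ * ∑ s', P s a s' * U s' ≤ U s) (s : S) : V s ≤ U s := by
  obtain ⟨s₀, hs₀⟩ := Finite.exists_min fun s => U s - V s
  obtain ⟨a, -, ha⟩ := exists_mem_eq_sup' (univ_nonempty (α := A))
    fun a => R s₀ + γ * ∑ s', P s₀ a s' * V s'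
  have hVa : V s₀ = R s₀ + γ * ∑ s', P s₀ a s' * V s' := (hV s₀).symm.trans ha
  have hmean : U s₀ - V s₀ ≤ ∑ s', P s₀ a s' * U s' - ∑ s', P s₀ a s' * V s' := by
    calc U s₀ - V s₀ = ∑ s', P s₀ a s' * (U s₀ - V s₀) := by rw [← sum_mul, hP1, one_mul]
      _ ≤ ∑ s', P s₀ a s' * (U s' - V s') :=
        sum_le_sum fun s' _ => mul_le_mul_of_nonneg_left (hs₀ s') (hP0 s₀ a s')
      _ = _ := by simp only [mul_sub, sum_sub_distrib]
  have hmin : 0 ≤ U s₀ - V s₀ := by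
    nlinarith [hU s₀ a, mul_le_mul_of_nonneg_left hmean hγ0]
  linarith [hs₀ s]

/-- Shifting an approximation of the optimal value function by a multiple of a Lyapunov function
makes it satisfy all Bellman constraints. -/
theorem bellman_constraints_add_lyapunov {P : S → A → S → ℝ} {R : S → ℝ} {γ : ℝ}
    (hγ0 : 0 ≤ γ) (hP0 : ∀ s a s', 0 ≤ P s a s')
    {V : S → ℝ} (hV : ∀ s, bellman P R γ V s = V s) {L : S → ℝ} {β : ℝ} (hβ1 : β < 1)
    (hL : ∀ s, γ * Hop P L s ≤ β * L s) {U : S → ℝ} {c : ℝ} (hc : 0 ≤ c)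
    (hU : ∀ s, |V s - U s| ≤ c * L s) (s : S) (a : A) :
    R s + γ * ∑ s', P s a s' * (U s' + c * (2 / (1 - β) - 1) * L s') ≤
      U s + c * (2 / (1 - β) - 1) * L s := by
  have h1β : 0 < 1 - β := sub_pos.2 hβ1
  set K := 2 / (1 - β) - 1 with hK
  have hKβ : (1 + K) * β + 1 = K := by
    rw [hK]; field_simp; ring
  have hK0 : 0 ≤ 1 + K := by rw [hK, add_sub_cancel]; positivity
  have hVa : R s + γ * ∑ s', P s a s' * V s' ≤ V s :=
    (le_sup' (fun a => R s + γ * ∑ s', P s a s' * V s') (mem_univ a)).trans (hV s).le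
  have hLa : γ * ∑ s', P s a s' * L s' ≤ β * L s :=
    (mul_le_mul_of_nonneg_left
      (le_sup' (fun a => ∑ s', P s a s' * L s') (mem_univ a)) hγ0).trans (hL s)
  have hsum : ∑ s', P s a s' * (U s' + c * K * L s') ≤
      ∑ s', P s a s' * V s' + c * (1 + K) * ∑ s', P s a s' * L s' := by
    rw [mul_sum, ← sum_add_distrib]
    refine sum_le_sum fun s' _ => ?_
    have := mul_le_mul_of_nonneg_left (neg_le_of_abs_le (hU s')) (hP0 s a s')
    linarith
  have hγsum := mul_le_mul_of_nonneg_left hsum hγ0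
  have hcL := mul_le_mul_of_nonneg_left hLa (mul_nonneg hc hK0)
  have hVU := le_of_abs_le (hU s)
  have hcK : c * (1 + K) * (β * L s) + c * L s = c * K * L s := by
    linear_combination (c * L s) * hKβ
  linarith

end RALPBounds

/-- Theorem 1 of the paper, as a bound relating the RALP solution for the
MDP with reward `R₂` to the optimal value function `V₁*` of the MDP with reward `R₁`. -/
theorem statement_0 {S A : Type*} [Fintype S] [Nonempty S] [Fintype A] [Nonempty A]
    (P : S → A → S → ℝ) (R₁ R₂ : S → ℝ) (γ : ℝ)
    (hγ0 : 0 ≤ γ) (hγ1 : γ < 1)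
    (hP0 : ∀ s a s', 0 ≤ P s a s') (hP1 : ∀ s a, ∑ s', P s a s' = 1)
    (V₁ : S → ℝ) (hV₁ : ∀ s, bellman P R₁ γ V₁ s = V₁ s)
    (V₂ : S → ℝ) (hV₂ : ∀ s, bellman P R₂ γ V₂ s = V₂ s)
    (εp : ℝ) (hεp : 0 ≤ εp)
    (hVdiff : ∀ s, |V₁ s - V₂ s| ≤ 2 * εp / (1 - γ))
    {k : ℕ} (Φ : S → Fin (k + 1) → ℝ) (hbias : ∀ s, Φ s 0 = 1)
    (ψ : ℝ) (hψ : 0 < ψ)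
    (wL : Fin (k + 1) → ℝ) (β : ℝ) (hβ0 : 0 ≤ β) (hβ1 : β < 1)
    (hLpos : ∀ s, 0 < phiW Φ wL s)
    (hLyap : ∀ s, γ * Hop P (phiW Φ wL) s ≤ β * phiW Φ wL s)
    (ρ : S → ℝ) (hρ0 : ∀ s, 0 ≤ ρ s) (hρ1 : ∑ s, ρ s = 1)
    (wstar : Fin (k + 1) → ℝ) (hwstarW : normNeg1 wstar ≤ ψ)
    (hwstarMin : ∀ w : Fin (k + 1) → ℝ, normNeg1 w ≤ ψ →
      wmaxNorm (phiW Φ wL) (fun s => V₂ s - phiW Φ wstar s) ≤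
        wmaxNorm (phiW Φ wL) (fun s => V₂ s - phiW Φ w s))
    (wbar : Fin (k + 1) → ℝ)
    (hwbar : wbar = fun i => wstar i +
      wmaxNorm (phiW Φ wL) (fun s => V₂ s - phiW Φ wstar s) * (2 / (1 - β) - 1) * wL i)
    (hwbarW : normNeg1 wbar ≤ ψ)
    (wtilde : Fin (k + 1) → ℝ)
    (hwtilde : RALPsolution P R₂ γ Φ ψ ρ wtilde) :
    w1Norm ρ (fun s => V₁ s - phiW Φ wtilde s) ≤
      2 * (∑ s, ρ s * phiW Φ wL s) / (1 - β) *
        wmaxNorm (phiW Φ wL) (fun s => V₂ s - phiW Φ wstar s) +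
      2 * εp / (1 - γ) := by
  set L := phiW Φ wL
  set c := wmaxNorm L fun s => V₂ s - phiW Φ wstar s
  have h1β : 0 < 1 - β := sub_pos.2 hβ1
  have hc : 0 ≤ c := wmaxNorm_nonneg hLpos _
  have hstar : ∀ s, |V₂ s - phiW Φ wstar s| ≤ c * L s :=
    abs_le_wmaxNorm_mul hLpos fun s => V₂ s - phiW Φ wstar s
  have hbar : ∀ s, phiW Φ wbar s = phiW Φ wstar s + c * (2 / (1 - β) - 1) * L s := fun s => by
    rw [hwbar, phiW_add_mul]
  have hfeas : RALPfeasible P R₂ γ Φ ψ wbar := by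
    refine ⟨hwbarW, fun s a => ?_⟩
    simp only [hbar]
    exact bellman_constraints_add_lyapunov hγ0 hP0 hV₂ hβ1 hLyap hc hstar s a
  have hdom := le_of_bellman_constraints hγ0 hγ1 hP0 hP1 hV₂ hwtilde.1.2
  have hbound : ∀ s, phiW Φ wbar s ≤ V₂ s + 2 / (1 - β) * c * L s := fun s => by
    rw [hbar]
    linarith [neg_le_of_abs_le (hstar s)]
  calc w1Norm ρ (fun s => V₁ s - phiW Φ wtilde s)
      ≤ ∑ s, (ρ s * (2 * εp / (1 - γ)) + (ρ s * phiW Φ wtilde s - ρ s * V₂ s)) := by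
        refine sum_le_sum fun s _ => ?_
        rw [← mul_sub, ← mul_add]
        refine mul_le_mul_of_nonneg_left ?_ (hρ0 s)
        refine (abs_sub_le _ (V₂ s) _).trans (add_le_add (hVdiff s) ?_)
        rw [abs_of_nonpos (sub_nonpos.2 (hdom s)), neg_sub]
    _ = 2 * εp / (1 - γ) + (∑ s, ρ s * phiW Φ wtilde s - ∑ s, ρ s * V₂ s) := by
        rw [sum_add_distrib, sum_sub_distrib, ← sum_mul, hρ1, one_mul]
    _ ≤ 2 * εp / (1 - γ) + (∑ s, ρ s * (V₂ s + 2 / (1 - β) * c * L s) - ∑ s, ρ s * V₂ s) := by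
        refine add_le_add_right (sub_le_sub_right ?_ _) _
        exact (hwtilde.2 wbar hfeas).trans
          (sum_le_sum fun s _ => mul_le_mul_of_nonneg_left (hbound s) (hρ0 s))
    _ = 2 * (∑ s, ρ s * L s) / (1 - β) * c + 2 * εp / (1 - γ) := by
        have hsplit : ∑ s, ρ s * (V₂ s + 2 / (1 - β) * c * L s) =
            ∑ s, ρ s * V₂ s + 2 / (1 - β) * c * ∑ s, ρ s * L s := by
          rw [mul_sum, ← sum_add_distrib]
          exact sum_congr rfl fun s _ => by ring
        rw [hsplit]
        ring
end

section
/- For a finite MDP with optimal value function V*, feature matrix Φ, ψ > 0, and probability distribution ρ on S: (i) every RALP-feasible w satisfies ‖V* − Φw‖_{1,ρ} = ∑_s ρ(s)(Φw)(s) − ∑_s ρ(s)V*(s); consequently (ii) a RALP-feasible vector w̃ minimizes ∑_s ρ(s)(Φw)(s) over the RALP-feasible set if and only if it minimizes ‖V* − Φw‖_{1,ρ} over the RALP-feasible set. -/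
open Finset

/-- A fixed point of the Bellman operator lies below every `V` that satisfies all the state-action
constraints `R s + γ ∑ s', P s a s' * V s' ≤ V s`. -/
theorem le_of_bellman_eq_of_constraints {S A : Type*} [Fintype S] [Nonempty S] [Fintype A]
    [Nonempty A] {P : S → A → S → ℝ} {R : S → ℝ} {γ : ℝ} (hγ0 : 0 ≤ γ) (hγ1 : γ < 1)
    (hP0 : ∀ s a s', 0 ≤ P s a s') (hP1 : ∀ s a, ∑ s', P s a s' = 1)
    {U V : S → ℝ} (hU : ∀ s, bellman P R γ U s = U s)
    (hV : ∀ s a, R s + γ * ∑ s', P s a s' * V s' ≤ V s) (s : S) : U s ≤ V s := by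
  obtain ⟨m, hm⟩ := Finite.exists_max fun s => U s - V s
  obtain ⟨a, -, ha⟩ := exists_mem_eq_sup' (univ_nonempty (α := A))
    fun a => R m + γ * ∑ s', P m a s' * U s'
  have hUm : U m = R m + γ * ∑ s', P m a s' * U s' := (hU m).symm.trans ha
  have hsum : ∑ s', P m a s' * U s' - ∑ s', P m a s' * V s' ≤ U m - V m :=
    calc ∑ s', P m a s' * U s' - ∑ s', P m a s' * V s'
        = ∑ s', P m a s' * (U s' - V s') := by simp only [mul_sub, sum_sub_distrib]
      _ ≤ ∑ s', P m a s' * (U m - V m) :=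
        sum_le_sum fun s' _ => mul_le_mul_of_nonneg_left (hm s') (hP0 m a s')
      _ = U m - V m := by rw [← sum_mul, hP1, one_mul]
  have hγ := mul_le_mul_of_nonneg_left hsum hγ0
  have hVm := hV m a
  have hmax : U m - V m ≤ 0 := by nlinarith
  linarith [hm s]

/-- If `U ≤ V` pointwise, the weighted L¹ distance is the difference of the weighted sums. -/
theorem w1Norm_sub_of_le {S : Type*} [Fintype S] (ρ : S → ℝ) {U V : S → ℝ}
    (h : ∀ s, U s ≤ V s) :
    w1Norm ρ (fun s => U s - V s) = (∑ s, ρ s * V s) - ∑ s, ρ s * U s := by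
  rw [w1Norm, ← sum_sub_distrib]
  refine sum_congr rfl fun s _ => ?_
  rw [abs_of_nonpos (sub_nonpos.2 (h s))]
  ring

/-- for RALP-feasible `w`, `‖V* − Φw‖_{1,ρ} = ∑ ρ(Φw) − ∑ ρ V*`; hence a
feasible `w̃` minimizes the RALP objective iff it minimizes `‖V* − Φw‖_{1,ρ}`. -/
theorem statement_9 {S A : Type*} [Fintype S] [Nonempty S] [Fintype A] [Nonempty A]
    (P : S → A → S → ℝ) (R : S → ℝ) (γ : ℝ) (hγ0 : 0 ≤ γ) (hγ1 : γ < 1)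
    (hP0 : ∀ s a s', 0 ≤ P s a s') (hP1 : ∀ s a, ∑ s', P s a s' = 1)
    (Vstar : S → ℝ) (hVstar : ∀ s, bellman P R γ Vstar s = Vstar s)
    {k : ℕ} (Φ : S → Fin (k + 1) → ℝ) (hbias : ∀ s, Φ s 0 = 1)
    (ψ : ℝ) (hψ : 0 < ψ)
    (ρ : S → ℝ) (hρ0 : ∀ s, 0 ≤ ρ s) (hρ1 : ∑ s, ρ s = 1) :
    (∀ w : Fin (k + 1) → ℝ, RALPfeasible P R γ Φ ψ w →
      w1Norm ρ (fun s => Vstar s - phiW Φ w s) =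
        (∑ s, ρ s * phiW Φ w s) - ∑ s, ρ s * Vstar s) ∧
    (∀ wtilde : Fin (k + 1) → ℝ, RALPfeasible P R γ Φ ψ wtilde →
      ((∀ w, RALPfeasible P R γ Φ ψ w →
          ∑ s, ρ s * phiW Φ wtilde s ≤ ∑ s, ρ s * phiW Φ w s) ↔
        (∀ w, RALPfeasible P R γ Φ ψ w →
          w1Norm ρ (fun s => Vstar s - phiW Φ wtilde s) ≤
            w1Norm ρ (fun s => Vstar s - phiW Φ w s)))) := by
  have key : ∀ w : Fin (k + 1) → ℝ, RALPfeasible P R γ Φ ψ w →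
      w1Norm ρ (fun s => Vstar s - phiW Φ w s) =
        (∑ s, ρ s * phiW Φ w s) - ∑ s, ρ s * Vstar s := fun w hw =>
    w1Norm_sub_of_le ρ (le_of_bellman_eq_of_constraints hγ0 hγ1 hP0 hP1 hVstar hw.2)
  refine ⟨key, fun wtilde hwt => forall₂_congr fun w hw => ?_⟩
  rw [key wtilde hwt, key w hw, sub_le_sub_iff_right]
end

section
/- Consider a finite MDP with reward R, and a feature matrix Φ whose bias feature is constantly 1 and whose every non-bias feature i satisfies ∑_{x∈S} |Φ_i(x)| ≤ 1. Fix states s, σ ∈ S and an action a ∈ A such that |Φ_i(σ) − Φ_i(s)| ≤ δ_φ for every feature i, |R(σ) − R(s)| ≤ δ_R, and |P(s'|σ,a) − P(s'|s,a)| ≤ δ_P for every s' ∈ S. Then any w ∈ ℝ^k with ‖w‖_{-1} ≤ ψ satisfying the sampled constraint R(σ) + γ ∑_{s'} P(s'|σ,a)(Φw)(s') ≤ (Φw)(σ) also satisfies the implied constraint R(s) + γ ∑_{s'} P(s'|s,a)(Φw)(s') ≤ (Φw)(s) + 2(δ_φψ + δ_R + δ_Pψ). -/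
open Finset

theorem abs_sum_mul_le_mul_normNeg1 {k : ℕ} {c w : Fin (k + 1) → ℝ} {δ : ℝ}
    (hc0 : c 0 = 0) (hc : ∀ i, i ≠ 0 → |c i| ≤ δ) :
    |∑ i, c i * w i| ≤ δ * normNeg1 w := by
  rw [← Finset.add_sum_erase _ _ (Finset.mem_univ 0), hc0, zero_mul, zero_add, normNeg1,
    Finset.mul_sum]
  refine (Finset.abs_sum_le_sum_abs _ _).trans (Finset.sum_le_sum fun i hi => ?_)
  rw [abs_mul]
  exact mul_le_mul_of_nonneg_right (hc i (Finset.ne_of_mem_erase hi)) (abs_nonneg _)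

theorem abs_phiW_sub_le {S : Type*} {k : ℕ} {Φ : S → Fin (k + 1) → ℝ} (hbias : ∀ x, Φ x 0 = 1)
    {s σ : S} {δ : ℝ} (hφ : ∀ i, |Φ σ i - Φ s i| ≤ δ) (w : Fin (k + 1) → ℝ) :
    |phiW Φ w σ - phiW Φ w s| ≤ δ * normNeg1 w := by
  have h : phiW Φ w σ - phiW Φ w s = ∑ i, (Φ σ i - Φ s i) * w i := by
    simp only [phiW, sub_mul, Finset.sum_sub_distrib]
  rw [h]
  exact abs_sum_mul_le_mul_normNeg1 (by simp [hbias]) fun i _ => hφ i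

theorem abs_sum_mul_phiW_le {S : Type*} [Fintype S] {k : ℕ} {Φ : S → Fin (k + 1) → ℝ}
    (hbias : ∀ x, Φ x 0 = 1) (hΦnorm : ∀ i : Fin (k + 1), i ≠ 0 → ∑ x, |Φ x i| ≤ 1)
    {d : S → ℝ} {δ : ℝ} (hδ : 0 ≤ δ) (hd0 : ∑ x, d x = 0) (hd : ∀ x, |d x| ≤ δ)
    (w : Fin (k + 1) → ℝ) :
    |∑ x, d x * phiW Φ w x| ≤ δ * normNeg1 w := by
  have h : ∑ x, d x * phiW Φ w x = ∑ i, (∑ x, d x * Φ x i) * w i := by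
    simp only [phiW, Finset.mul_sum, Finset.sum_mul, mul_assoc]
    exact Finset.sum_comm
  rw [h]
  refine abs_sum_mul_le_mul_normNeg1 (by simpa [hbias] using hd0) fun i hi => ?_
  calc |∑ x, d x * Φ x i| ≤ ∑ x, |d x * Φ x i| := Finset.abs_sum_le_sum_abs _ _
    _ ≤ ∑ x, δ * |Φ x i| := Finset.sum_le_sum fun x _ => by
        rw [abs_mul]
        exact mul_le_mul_of_nonneg_right (hd x) (abs_nonneg _)
    _ = δ * ∑ x, |Φ x i| := (Finset.mul_sum _ _ _).symm
    _ ≤ δ := mul_le_of_le_one_right hδ (hΦnorm i hi)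

/-- the sampled constraint at `σ` implies the constraint at a nearby
state `s` up to slack `2(δ_φψ + δ_R + δ_Pψ)`. -/
theorem statement_11 {S A : Type*} [Fintype S] [Nonempty S] [Fintype A] [Nonempty A]
    (P : S → A → S → ℝ) (R : S → ℝ) (γ : ℝ) (hγ0 : 0 ≤ γ) (hγ1 : γ < 1)
    (hP0 : ∀ s a s', 0 ≤ P s a s') (hP1 : ∀ s a, ∑ s', P s a s' = 1)
    {k : ℕ} (Φ : S → Fin (k + 1) → ℝ) (hbias : ∀ x, Φ x 0 = 1)
    (hΦnorm : ∀ i : Fin (k + 1), i ≠ 0 → ∑ x, |Φ x i| ≤ 1)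
    (ψ δφ δR δP : ℝ) (hψ : 0 < ψ)
    (s σ : S) (a : A)
    (hφ : ∀ i, |Φ σ i - Φ s i| ≤ δφ)
    (hR : |R σ - R s| ≤ δR)
    (hPd : ∀ s', |P σ a s' - P s a s'| ≤ δP)
    (w : Fin (k + 1) → ℝ) (hw : normNeg1 w ≤ ψ)
    (hcon : R σ + γ * ∑ s', P σ a s' * phiW Φ w s' ≤ phiW Φ w σ) :
    R s + γ * ∑ s', P s a s' * phiW Φ w s' ≤
      phiW Φ w s + 2 * (δφ * ψ + δR + δP * ψ) := by
  have hδφ : 0 ≤ δφ := (abs_nonneg _).trans (hφ 0)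
  have hδR : 0 ≤ δR := (abs_nonneg _).trans hR
  have hδP : 0 ≤ δP := (abs_nonneg _).trans (hPd s)
  have hφw : |phiW Φ w σ - phiW Φ w s| ≤ δφ * ψ :=
    (abs_phiW_sub_le hbias hφ w).trans (mul_le_mul_of_nonneg_left hw hδφ)
  have hPw : |∑ x, (P σ a x - P s a x) * phiW Φ w x| ≤ δP * ψ :=
    (abs_sum_mul_phiW_le hbias hΦnorm hδP (by simp [hP1]) hPd w).trans
      (mul_le_mul_of_nonneg_left hw hδP)
  have hγP : |γ * ∑ x, (P σ a x - P s a x) * phiW Φ w x| ≤ δP * ψ := by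
    rw [abs_mul, abs_of_nonneg hγ0]
    exact (mul_le_of_le_one_left (abs_nonneg _) hγ1.le).trans hPw
  simp only [sub_mul, Finset.sum_sub_distrib, mul_sub] at hγP
  have hφψ : 0 ≤ δφ * ψ := mul_nonneg hδφ hψ.le
  have hPψ : 0 ≤ δP * ψ := mul_nonneg hδP hψ.le
  linarith [(abs_le.mp hφw).2, (abs_le.mp hR).1, (abs_le.mp hγP).1]
end
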